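/- arXiv:2507.08433 — 2 statements merged into one kernel-verified Lean document; each statement's English description precedes it below -/
import Mathlib

section
/- Let r ≥ t be positive integers and let k be an integer with 1 < k < t. Then msad_k(K_{r,t}) = t − k; that is, K_{r,t} has a k-multiset antiresolving set of cardinality t − k, and every k-multiset antiresolving set of K_{r,t} has cardinality at least t − k. -/
open Finset

/-- The multiset representation of `v` with respect to `S`:
the multiset of distances from `v` to the vertices of `S`, counted with multiplicity. -/
noncomputable def mrep {V : Type*} (G : SimpleGraph V) (S : Finset V) (v : V) : Multiset ℕ :=
  S.val.map (fun s => G.dist v s)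

open scoped Classical in
/-- The set of vertices outside `S` having the same multiset representation as `u`. -/
noncomputable def mclass {V : Type*} [Fintype V] (G : SimpleGraph V) (S : Finset V)
    (u : V) : Finset V :=
  Finset.univ.filter (fun v => v ∉ S ∧ mrep G S v = mrep G S u)

open scoped Classical in
/-- `S` is a `k`-multiset antiresolving set (`k`-MARS) of `G`: `S` is nonempty, its complement
is nonempty, and `k` is the largest integer such that every vertex `u ∉ S` has at least `k`
vertices outside `S` (including itself) with its same multiset representation. -/
def IsMARS {V : Type*} [Fintype V] (G : SimpleGraph V) (S : Finset V) (k : ℕ) : Prop :=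
  S.Nonempty ∧ Sᶜ.Nonempty ∧
    (∀ u ∉ S, k ≤ (mclass G S u).card) ∧ (∃ u ∉ S, (mclass G S u).card = k)

/-- `msad_k(G) = m`: `G` has a `k`-multiset antiresolving set of cardinality `m`, and every
`k`-multiset antiresolving set of `G` has cardinality at least `m`. -/
def MsadEq {V : Type*} [Fintype V] (G : SimpleGraph V) (k m : ℕ) : Prop :=
  (∃ S : Finset V, IsMARS G S k ∧ S.card = m) ∧
    ∀ S : Finset V, IsMARS G S k → m ≤ S.card

theorem mem_mclass {V : Type*} [Fintype V] {G : SimpleGraph V} {S : Finset V} {u v : V} :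
    v ∈ mclass G S u ↔ v ∉ S ∧ mrep G S v = mrep G S u := by
  simp [mclass]

open SimpleGraph in
/-- Two distinct vertices with a common neighbour that are not adjacent are at distance `2`. -/
theorem SimpleGraph.dist_eq_two_of_common_neighbor {V : Type*} {G : SimpleGraph V} {u v w : V}
    (hne : u ≠ v) (hnadj : ¬ G.Adj u v) (huw : G.Adj u w) (hwv : G.Adj w v) :
    G.dist u v = 2 := by
  have hle : G.dist u v ≤ 2 := dist_le (Walk.cons huw (Walk.cons hwv Walk.nil))
  have hreach : G.Reachable u v := huw.reachable.trans hwv.reachable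
  have h0 : G.dist u v ≠ 0 := (hreach.pos_dist_of_ne hne).ne'
  have h1 : G.dist u v ≠ 1 := fun h => hnadj (dist_eq_one_iff_adj.mp h)
  omega

section CompleteBipartite

variable {α β : Type*}

theorem completeBipartiteGraph_dist_inl_inr (a : α) (b : β) :
    (completeBipartiteGraph α β).dist (.inl a) (.inr b) = 1 := by
  simp [SimpleGraph.dist_eq_one_iff_adj]

theorem completeBipartiteGraph_dist_inr_inl (b : β) (a : α) :
    (completeBipartiteGraph α β).dist (.inr b) (.inl a) = 1 := by
  simp [SimpleGraph.dist_eq_one_iff_adj]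

theorem completeBipartiteGraph_dist_inl_inl [Nonempty β] {a a' : α} (h : a ≠ a') :
    (completeBipartiteGraph α β).dist (.inl a) (.inl a') = 2 := by
  obtain ⟨b⟩ := ‹Nonempty β›
  exact SimpleGraph.dist_eq_two_of_common_neighbor (w := .inr b)
    (by simpa using h) (by simp) (by simp) (by simp)

theorem completeBipartiteGraph_dist_inr_inr [Nonempty α] {b b' : β} (h : b ≠ b') :
    (completeBipartiteGraph α β).dist (.inr b) (.inr b') = 2 := by
  obtain ⟨a⟩ := ‹Nonempty α›
  exact SimpleGraph.dist_eq_two_of_common_neighbor (w := .inl a)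
    (by simpa using h) (by simp) (by simp) (by simp)

theorem mrep_completeBipartiteGraph_inl [Nonempty β] {S : Finset (α ⊕ β)} {a a' : α}
    (ha : .inl a ∉ S) (ha' : .inl a' ∉ S) :
    mrep (completeBipartiteGraph α β) S (.inl a) =
      mrep (completeBipartiteGraph α β) S (.inl a') := by
  refine Multiset.map_congr rfl ?_
  rintro (x | y) hs
  · rw [completeBipartiteGraph_dist_inl_inl (by rintro rfl; exact ha hs),
      completeBipartiteGraph_dist_inl_inl (by rintro rfl; exact ha' hs)]
  · simp only [completeBipartiteGraph_dist_inl_inr]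

theorem mrep_completeBipartiteGraph_inr [Nonempty α] {S : Finset (α ⊕ β)} {b b' : β}
    (hb : .inr b ∉ S) (hb' : .inr b' ∉ S) :
    mrep (completeBipartiteGraph α β) S (.inr b) =
      mrep (completeBipartiteGraph α β) S (.inr b') := by
  refine Multiset.map_congr rfl ?_
  rintro (x | y) hs
  · simp only [completeBipartiteGraph_dist_inr_inl]
  · rw [completeBipartiteGraph_dist_inr_inr (by rintro rfl; exact hb hs),
      completeBipartiteGraph_dist_inr_inr (by rintro rfl; exact hb' hs)]

/-- For a nonempty set inside the right side, the two sides have different representations. -/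
theorem mrep_inl_ne_mrep_inr [Nonempty α] {T : Finset β} (hT : T.Nonempty) (a : α) {b : β}
    (hb : b ∉ T) :
    mrep (completeBipartiteGraph α β) (T.map .inr) (.inl a) ≠
      mrep (completeBipartiteGraph α β) (T.map .inr) (.inr b) := by
  intro h
  obtain ⟨c, hc⟩ := hT
  have hmem : 1 ∈ mrep (completeBipartiteGraph α β) (T.map .inr) (.inl a) :=
    Multiset.mem_map.mpr ⟨.inr c, by simpa using hc, completeBipartiteGraph_dist_inl_inr a c⟩
  rw [h] at hmem
  obtain ⟨s, hs, hs1⟩ := Multiset.mem_map.mp hmem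
  obtain ⟨y, hy, rfl⟩ := mem_map.mp (mem_val.mp hs)
  have := completeBipartiteGraph_dist_inr_inr (α := α) (b := b) (b' := y)
    (by rintro rfl; exact hb hy)
  simp only [Function.Embedding.inr_apply] at hs1
  omega

variable [Fintype α] [Fintype β]

/-- Every vertex on the left side lies in `S` or has the representation of `a`. -/
theorem card_le_card_mclass_add_card_inl [Nonempty β] {S : Finset (α ⊕ β)} {a : α}
    (ha : .inl a ∉ S) :
    Fintype.card α ≤ (mclass (completeBipartiteGraph α β) S (.inl a)).card + S.card := by
  classical
  calc Fintype.card α = ((univ : Finset α).map .inl).card := by simp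
    _ ≤ (mclass (completeBipartiteGraph α β) S (.inl a) ∪ S).card := by
      refine card_le_card fun v hv => ?_
      obtain ⟨x, -, rfl⟩ := mem_map.mp hv
      by_cases hx : .inl x ∈ S
      · exact mem_union_right _ hx
      · refine mem_union_left _ (mem_mclass.mpr ⟨hx, ?_⟩)
        exact mrep_completeBipartiteGraph_inl hx ha
    _ ≤ _ := card_union_le _ _

/-- Every vertex on the right side lies in `S` or has the representation of `b`. -/
theorem card_le_card_mclass_add_card_inr [Nonempty α] {S : Finset (α ⊕ β)} {b : β}
    (hb : .inr b ∉ S) :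
    Fintype.card β ≤ (mclass (completeBipartiteGraph α β) S (.inr b)).card + S.card := by
  classical
  calc Fintype.card β = ((univ : Finset β).map .inr).card := by simp
    _ ≤ (mclass (completeBipartiteGraph α β) S (.inr b) ∪ S).card := by
      refine card_le_card fun v hv => ?_
      obtain ⟨x, -, rfl⟩ := mem_map.mp hv
      by_cases hx : .inr x ∈ S
      · exact mem_union_right _ hx
      · refine mem_union_left _ (mem_mclass.mpr ⟨hx, ?_⟩)
        exact mrep_completeBipartiteGraph_inr hx hb
    _ ≤ _ := card_union_le _ _

theorem card_mclass_inl [Nonempty β] {T : Finset β} (hT : T.Nonempty) (a : α) :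
    (mclass (completeBipartiteGraph α β) (T.map .inr) (.inl a)).card = Fintype.card α := by
  classical
  have : Nonempty α := ⟨a⟩
  have heq : mclass (completeBipartiteGraph α β) (T.map .inr) (.inl a) =
      (univ : Finset α).map .inl := by
    ext v
    rcases v with x | y
    · simpa [mem_mclass] using mrep_completeBipartiteGraph_inl (S := T.map .inr) (a := x) (a' := a)
        (by simp) (by simp)
    · simpa [mem_mclass] using fun hy => (mrep_inl_ne_mrep_inr hT a hy).symm
  rw [heq, card_map, card_univ]

theorem card_mclass_inr [Nonempty α] {T : Finset β} (hT : T.Nonempty) {b : β} (hb : b ∉ T) :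
    (mclass (completeBipartiteGraph α β) (T.map .inr) (.inr b)).card =
      Fintype.card β - T.card := by
  classical
  have heq : mclass (completeBipartiteGraph α β) (T.map .inr) (.inr b) = Tᶜ.map .inr := by
    ext v
    rcases v with x | y
    · simpa [mem_mclass] using mrep_inl_ne_mrep_inr hT x hb
    · simpa [mem_mclass] using fun hy => mrep_completeBipartiteGraph_inr (α := α)
        (S := T.map .inr) (b := y) (b' := b) (by simpa using hy) (by simpa using hb)
  rw [heq, card_map, card_compl]

end CompleteBipartite

/-- for `r ≥ t ≥ 1` and `1 < k < t`, `msad_k(K_{r,t}) = t - k`. -/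
theorem stmt5 (r t k : ℕ) (ht : 1 ≤ t) (hrt : t ≤ r) (hk1 : 1 < k) (hkt : k < t) :
    MsadEq (completeBipartiteGraph (Fin r) (Fin t)) k (t - k) := by
  have : Nonempty (Fin t) := ⟨⟨0, ht⟩⟩
  have : Nonempty (Fin r) := ⟨⟨0, ht.trans hrt⟩⟩
  constructor
  · obtain ⟨T, -, hTcard⟩ := exists_subset_card_eq (s := (univ : Finset (Fin t))) (n := t - k)
      (by simp)
    have hT : T.Nonempty := card_pos.mp (by omega)
    obtain ⟨b, hb⟩ : ∃ b, b ∉ T := by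
      by_contra! h
      have := card_univ (α := Fin t)
      rw [← eq_univ_iff_forall.mpr h, Fintype.card_fin] at this
      omega
    refine ⟨T.map .inr, ⟨by simpa using hT, ⟨.inr b, by simpa using hb⟩, ?_,
      .inr b, by simpa using hb, ?_⟩, by simpa using hTcard⟩
    · rintro (x | y) hu
      · rw [card_mclass_inl hT, Fintype.card_fin]
        omega
      · rw [card_mclass_inr hT (by simpa using hu), Fintype.card_fin]
        omega
    · rw [card_mclass_inr hT hb, Fintype.card_fin]
      omega
  · rintro S ⟨-, -, -, u | u, hu, hcard⟩
    · have := card_le_card_mclass_add_card_inl hu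
      rw [hcard, Fintype.card_fin] at this
      omega
    · have := card_le_card_mclass_add_card_inr hu
      rw [hcard, Fintype.card_fin] at this
      omega
end

section
/- Let W_{1,n−1} be the wheel graph on n ≥ 7 vertices, let k be an odd integer with 5 ≤ k < n − 1, and let t be the remainder of (n − 1 − k) upon division by 3. Then: (a) if 2n ≥ 5k + 5, then msad_k(W_{1,n−1}) = min{ ⌊(n − 1 − k)/3⌋ + t + 1, (3k + 3)/2 }; (b) if 2k < n and 2n < 5k + 5, then msad_k(W_{1,n−1}) = n − k; (c) if n ≤ 2k, then W_{1,n−1} contains no k-multiset antiresolving set. -/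
open Finset

/-- The wheel graph `W_{1,m}` on `m + 1` vertices: the hub `none` is adjacent to every rim
vertex `some i`, and rim vertices `some i`, `some j` are adjacent iff `j ≡ i ± 1 (mod m)`. -/
def wheel (m : ℕ) : SimpleGraph (Option (Fin m)) :=
  SimpleGraph.fromRel (fun u v =>
    u = none ∨ ∃ i j : Fin m, u = some i ∧ v = some j ∧ (j : ℕ) = ((i : ℕ) + 1) % m)

section Wheel

variable {m : ℕ}

theorem card_filter_val (P : ℕ → Prop) [DecidablePred P] :
    #{i : Fin m | P i.val} = #{x ∈ range m | P x} := by
  rw [← Finset.card_map Fin.valEmbedding]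
  congr 1
  ext x
  simp only [Finset.mem_map, Finset.mem_filter, Finset.mem_univ, true_and, Fin.valEmbedding_apply,
    Finset.mem_range]
  exact ⟨fun ⟨i, hi, h⟩ => h ▸ ⟨i.isLt, hi⟩, fun ⟨hx, h⟩ => ⟨⟨x, hx⟩, h, rfl⟩⟩

theorem card_filter_val_Ico {a b : ℕ} (hb : b ≤ m) :
    #{i : Fin m | a ≤ i.val ∧ i.val < b} = b - a := by
  rw [card_filter_val (fun x => a ≤ x ∧ x < b), ← Nat.card_Ico]
  congr 1
  ext x
  simp only [Finset.mem_filter, Finset.mem_range, Finset.mem_Ico]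
  omega

theorem card_filter_val_odd {a : ℕ} (ha : 2 * a ≤ m) :
    #{i : Fin m | i.val < 2 * a ∧ i.val % 2 = 1} = a := by
  rw [card_filter_val (fun x => x < 2 * a ∧ x % 2 = 1)]
  conv_rhs => rw [← Finset.card_range a,
    ← Finset.card_image_of_injective (f := fun x => 2 * x + 1) _ (fun x y h => by simpa using h)]
  congr 1
  ext x
  simp only [Finset.mem_filter, Finset.mem_range, Finset.mem_image]
  exact ⟨fun h => ⟨x / 2, by omega, by omega⟩, fun ⟨y, hy, h⟩ => by omega⟩

variable [NeZero m]

theorem Fin.val_one_of_two_le (hm : 2 ≤ m) : (1 : Fin m).val = 1 := by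
  have : (1 : Fin m).val = 1 % m := rfl
  rw [this, Nat.mod_eq_of_lt (by omega)]

theorem Fin.val_add_one_cyclic (hm : 2 ≤ m) (i : Fin m) :
    (i + 1).val = if i.val + 1 = m then 0 else i.val + 1 := by
  have hi := i.isLt
  rw [Fin.val_add, Fin.val_one_of_two_le hm]
  split_ifs with h
  · rw [h, Nat.mod_self]
  · exact Nat.mod_eq_of_lt (by omega)

theorem Fin.val_sub_one_cyclic (hm : 2 ≤ m) (i : Fin m) :
    (i - 1).val = if i.val = 0 then m - 1 else i.val - 1 := by
  have h := Fin.val_add_one_cyclic hm (i - 1)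
  rw [sub_add_cancel] at h
  have := (i - 1).isLt
  split_ifs at h ⊢ <;> omega

theorem wheel_adj_none_some (i : Fin m) : (wheel m).Adj none (some i) := by
  simp [wheel, SimpleGraph.fromRel_adj]

theorem wheel_adj_some_some (hm : 2 ≤ m) (i j : Fin m) :
    (wheel m).Adj (some i) (some j) ↔ j = i + 1 ∨ j = i - 1 := by
  have key : ∀ a b : Fin m, (b : ℕ) = ((a : ℕ) + 1) % m ↔ b = a + 1 := by
    intro a b
    rw [Fin.ext_iff, Fin.val_add, Fin.val_one_of_two_le hm]
  have h1 := Fin.val_add_one_cyclic hm i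
  have h2 := Fin.val_sub_one_cyclic hm i
  have hi := i.isLt
  have hne : j = i + 1 ∨ j = i - 1 → i ≠ j := by
    rintro (rfl | rfl) h <;> rw [Fin.ext_iff] at h <;> split_ifs at h1 h2 <;> omega
  have hsub : i = j + 1 ↔ j = i - 1 := by
    rw [eq_sub_iff_add_eq, eq_comm]
  have hadj : (wheel m).Adj (some i) (some j) ↔ i ≠ j ∧ (j = i + 1 ∨ i = j + 1) := by
    simp [wheel, SimpleGraph.fromRel_adj, key]
  rw [hadj, hsub]
  exact ⟨And.right, fun h => ⟨hne h, h⟩⟩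

theorem wheel_dist_of_ne {u v : Option (Fin m)} (h : u ≠ v) :
    (wheel m).dist u v = 1 ∨ (wheel m).dist u v = 2 := by
  have hub : ∀ w : Option (Fin m), w ≠ none → (wheel m).Adj none w := by
    intro w hw
    obtain ⟨i, rfl⟩ := Option.ne_none_iff_exists'.mp hw
    exact wheel_adj_none_some i
  by_cases hu : u = none
  · subst hu
    exact Or.inl (SimpleGraph.dist_eq_one_iff_adj.mpr (hub v h.symm))
  by_cases hv : v = none
  · subst hv
    exact Or.inl (SimpleGraph.dist_eq_one_iff_adj.mpr (hub u h).symm)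
  let p : (wheel m).Walk u v := .cons (hub u hu).symm (.cons (hub v hv) .nil)
  have hle : (wheel m).dist u v ≤ 2 := SimpleGraph.dist_le p
  have hpos : 0 < (wheel m).dist u v := p.reachable.pos_dist_of_ne h
  omega

open scoped Classical in
theorem count_mrep {V : Type*} (G : SimpleGraph V) (S : Finset V) (v : V) (d : ℕ) :
    (mrep G S v).count d = #{s ∈ S | G.dist v s = d} := by
  rw [mrep, Multiset.count_map, Finset.card_def, Finset.filter_val]
  simp only [eq_comm]

open scoped Classical in
theorem wheel_mrep_eq_iff {S : Finset (Option (Fin m))} {u v : Option (Fin m)}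
    (hu : u ∉ S) (hv : v ∉ S) :
    mrep (wheel m) S v = mrep (wheel m) S u ↔
      #{s ∈ S | (wheel m).Adj v s} = #{s ∈ S | (wheel m).Adj u s} := by
  have hone : ∀ w, (mrep (wheel m) S w).count 1 = #{s ∈ S | (wheel m).Adj w s} := by
    intro w
    simp only [count_mrep, SimpleGraph.dist_eq_one_iff_adj]
  have htwo : ∀ w ∉ S, (mrep (wheel m) S w).count 1 + (mrep (wheel m) S w).count 2 = #S := by
    intro w hw
    rw [count_mrep, count_mrep,
      ← Finset.card_filter_add_card_filter_not (s := S) (fun s => (wheel m).dist w s = 1)]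
    congr 2
    refine Finset.filter_congr fun s hs => ?_
    rcases wheel_dist_of_ne (fun h => hw (h ▸ hs) : w ≠ s) with h | h <;> simp [h]
  have hother : ∀ w ∉ S, ∀ d, d ≠ 1 → d ≠ 2 → (mrep (wheel m) S w).count d = 0 := by
    intro w hw d h1 h2
    rw [count_mrep, Finset.card_eq_zero, Finset.filter_eq_empty_iff]
    intro s hs hd
    rcases wheel_dist_of_ne (fun h => hw (h ▸ hs) : w ≠ s) with h | h <;> omega
  rw [← hone, ← hone]
  refine ⟨fun h => by rw [h], fun h => Multiset.ext.mpr fun d => ?_⟩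
  by_cases h1 : d = 1
  · rw [h1, h]
  by_cases h2 : d = 2
  · have := htwo u hu
    have := htwo v hv
    rw [h2]
    omega
  rw [hother u hu d h1 h2, hother v hv d h1 h2]

/-- A `k`-MARS of the wheel with `k > 3` contains the hub. -/
theorem none_mem_of_isMARS (hm : 2 ≤ m) {S : Finset (Option (Fin m))} {k : ℕ} (hk : 3 < k)
    (h : IsMARS (wheel m) S k) : none ∈ S := by
  classical
  by_contra hS
  obtain ⟨⟨s, hs⟩, -, hle, -⟩ := h
  obtain ⟨j, rfl⟩ := Option.ne_none_iff_exists'.mp (fun h => hS (h ▸ hs) : s ≠ none)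
  have hsub : mclass (wheel m) S none ⊆ {none, some (j + 1), some (j - 1)} := by
    intro v hv
    simp only [mclass, Finset.mem_filter, Finset.mem_univ, true_and] at hv
    have hmem : (wheel m).dist v (some j) ∈ mrep (wheel m) S none := by
      rw [← hv.2]
      exact Multiset.mem_map_of_mem _ hs
    obtain ⟨s', hs', hd⟩ := Multiset.mem_map.mp hmem
    obtain ⟨j', rfl⟩ := Option.ne_none_iff_exists'.mp (fun h => hS (h ▸ hs') : s' ≠ none)
    rw [SimpleGraph.dist_eq_one_iff_adj.mpr (wheel_adj_none_some j'), eq_comm,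
      SimpleGraph.dist_eq_one_iff_adj] at hd
    cases v with
    | none => simp
    | some i =>
      have := (wheel_adj_some_some hm j i).mp hd.symm
      simpa using this
  have h1 := hle none hS
  have h2 := (Finset.card_le_card hsub).trans Finset.card_le_three
  omega

/-- The number of cyclic neighbours of `i` that lie in `R`. -/
def rimDegree (R : Finset (Fin m)) (i : Fin m) : ℕ :=
  (if i + 1 ∈ R then 1 else 0) + (if i - 1 ∈ R then 1 else 0)

/-- The number of vertices outside `R` with exactly `j` cyclic neighbours in `R`. -/
def rimClass (R : Finset (Fin m)) (j : ℕ) : ℕ :=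
  #{i : Fin m | i ∉ R ∧ rimDegree R i = j}

theorem rimDegree_lt (R : Finset (Fin m)) (i : Fin m) : rimDegree R i < 3 := by
  unfold rimDegree
  split_ifs <;> omega

theorem rimDegree_eq_zero_iff (R : Finset (Fin m)) (i : Fin m) :
    rimDegree R i = 0 ↔ i + 1 ∉ R ∧ i - 1 ∉ R := by
  simp [rimDegree]

theorem rimDegree_eq_two_iff (R : Finset (Fin m)) (i : Fin m) :
    rimDegree R i = 2 ↔ i + 1 ∈ R ∧ i - 1 ∈ R := by
  by_cases h : i + 1 ∈ R <;> by_cases h' : i - 1 ∈ R <;> simp [rimDegree, h, h']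

open scoped Classical in
theorem card_wheel_adj (hm : 3 ≤ m) (R : Finset (Fin m)) (i : Fin m) :
    #{s ∈ insertNone R | (wheel m).Adj (some i) s} = rimDegree R i + 1 := by
  have hne : i + 1 ≠ i - 1 := by
    have h1 := Fin.val_add_one_cyclic (by omega) i
    have h2 := Fin.val_sub_one_cyclic (by omega) i
    have hi := i.isLt
    intro h
    rw [Fin.ext_iff] at h
    split_ifs at h1 h2 <;> omega
  have hset : {s ∈ insertNone R | (wheel m).Adj (some i) s} =
      insertNone (R.filter (· = i + 1) ∪ R.filter (· = i - 1)) := by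
    ext s
    cases s with
    | none => simpa using (wheel_adj_none_some i).symm
    | some j =>
      simp only [Finset.mem_filter, Finset.some_mem_insertNone,
        wheel_adj_some_some (show 2 ≤ m by omega), Finset.mem_union]
      tauto
  rw [hset, Finset.card_insertNone, Finset.card_union_of_disjoint, rimDegree]
  · simp only [Finset.filter_eq']
    split_ifs <;> simp
  · rw [Finset.disjoint_filter]
    rintro _ - rfl
    exact hne

theorem card_mclass_insertNone (hm : 3 ≤ m) (R : Finset (Fin m)) {i : Fin m} (hi : i ∉ R) :
    #(mclass (wheel m) (insertNone R) (some i)) = rimClass R (rimDegree R i) := by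
  classical
  refine Eq.trans (congrArg Finset.card ?_) (Finset.card_map Function.Embedding.some)
  ext v
  cases v with
  | none => simp [mclass]
  | some j =>
    simp only [mclass, Finset.mem_filter, Finset.mem_univ, true_and, Finset.some_mem_insertNone,
      Finset.mem_map, Function.Embedding.some_apply, Option.some.injEq, exists_eq_right]
    refine and_congr_right fun hj => ?_
    rw [wheel_mrep_eq_iff (by simpa using hi) (by simpa using hj), card_wheel_adj hm,
      card_wheel_adj hm, Nat.add_right_cancel_iff]

theorem isMARS_insertNone_iff (hm : 3 ≤ m) (R : Finset (Fin m)) {k : ℕ} (hk : 0 < k) :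
    IsMARS (wheel m) (insertNone R) k ↔
      (∀ j < 3, rimClass R j = 0 ∨ k ≤ rimClass R j) ∧ ∃ j < 3, rimClass R j = k := by
  have hpos : ∀ j, 0 < rimClass R j → ∃ i ∉ R, rimDegree R i = j := by
    intro j hj
    obtain ⟨i, hi⟩ := Finset.card_pos.mp hj
    exact ⟨i, by simpa using hi⟩
  constructor
  · rintro ⟨-, -, hle, u, hu, hcard⟩
    refine ⟨fun j _ => ?_, ?_⟩
    · rcases Nat.eq_zero_or_pos (rimClass R j) with h | h
      · exact Or.inl h
      obtain ⟨i, hi, rfl⟩ := hpos j h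
      refine Or.inr ?_
      rw [← card_mclass_insertNone hm R hi]
      exact hle _ (by simpa using hi)
    · cases u with
      | none => simp at hu
      | some i =>
        rw [Finset.some_mem_insertNone] at hu
        exact ⟨_, rimDegree_lt R i, card_mclass_insertNone hm R hu ▸ hcard⟩
  · rintro ⟨hle, j, -, hj⟩
    obtain ⟨i, hi, rfl⟩ := hpos j (by omega)
    refine ⟨⟨none, by simp⟩, ⟨some i, by simpa using hi⟩, ?_, some i, by simpa using hi, ?_⟩
    · intro u hu
      cases u with
      | none => simp at hu
      | some i' =>
        rw [Finset.some_mem_insertNone] at hu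
        rw [card_mclass_insertNone hm R hu]
        refine (hle _ (rimDegree_lt R i')).resolve_left (Finset.card_pos.mpr ⟨i', ?_⟩).ne'
        simpa using hu
    · rw [card_mclass_insertNone hm R hi, hj]

theorem rimClass_add_card (R : Finset (Fin m)) :
    rimClass R 0 + rimClass R 1 + rimClass R 2 + #R = m := by
  have hR : #R = #{i : Fin m | i ∈ R} := by simp
  have hm : m = ∑ _i : Fin m, 1 := by simp
  conv_rhs => rw [hm]
  rw [hR]
  simp only [rimClass, Finset.card_filter, ← Finset.sum_add_distrib]
  refine Finset.sum_congr rfl fun i _ => ?_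
  have := rimDegree_lt R i
  by_cases hi : i ∈ R
  · simp [hi]
  · simp only [hi, not_false_eq_true, true_and]
    interval_cases rimDegree R i <;> simp

theorem card_eq_add_card_consecutive (R : Finset (Fin m)) :
    #R = #{i : Fin m | i ∈ R ∧ i + 1 ∉ R} + #{i : Fin m | i ∈ R ∧ i + 1 ∈ R} := by
  have hR : #R = #{i : Fin m | i ∈ R} := by simp
  rw [hR]
  simp only [Finset.card_filter, ← Finset.sum_add_distrib]
  refine Finset.sum_congr rfl fun i _ => ?_
  by_cases hi : i ∈ R <;> by_cases hi' : i + 1 ∈ R <;> simp [hi, hi']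

/-- Double counting of the cyclic edges leaving `R`. -/
theorem rimClass_one_add_two_mul (R : Finset (Fin m)) :
    rimClass R 1 + 2 * rimClass R 2 = 2 * #{i : Fin m | i ∈ R ∧ i + 1 ∉ R} := by
  have hB : #{i : Fin m | i ∉ R ∧ i - 1 ∈ R} = #{i : Fin m | i ∈ R ∧ i + 1 ∉ R} := by
    simp only [Finset.card_filter]
    rw [← Equiv.sum_comp (Equiv.addRight (1 : Fin m))
      (fun i => if i ∉ R ∧ i - 1 ∈ R then (1 : ℕ) else 0)]
    simp [and_comm]
  have hA : #{i : Fin m | i ∉ R ∧ i + 1 ∈ R} + #{i : Fin m | i ∈ R ∧ i + 1 ∈ R} = #R := by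
    have hR : #R = #{i : Fin m | i ∈ R} := by simp
    rw [hR]
    simp only [Finset.card_filter, ← Finset.sum_add_distrib]
    rw [← Equiv.sum_comp (Equiv.addRight (1 : Fin m)) (fun i => if i ∈ R then (1 : ℕ) else 0)]
    refine Finset.sum_congr rfl fun i _ => ?_
    by_cases hi : i ∈ R <;> by_cases hi' : i + 1 ∈ R <;> simp [hi, hi']
  have hsum : rimClass R 1 + (rimClass R 2 + rimClass R 2) =
      #{i : Fin m | i ∉ R ∧ i + 1 ∈ R} + #{i : Fin m | i ∉ R ∧ i - 1 ∈ R} := by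
    simp only [rimClass, Finset.card_filter, ← Finset.sum_add_distrib]
    refine Finset.sum_congr rfl fun i _ => ?_
    by_cases hi : i ∈ R <;> by_cases hi' : i + 1 ∈ R <;> by_cases hi'' : i - 1 ∈ R <;>
      simp [rimDegree, hi, hi', hi'']
  have := card_eq_add_card_consecutive R
  omega

/-- If no vertex outside `R` has exactly one neighbour in `R`, then vertices with no neighbour
in `R` propagate around the whole cycle. -/
theorem eq_empty_of_rimClass_one_eq_zero (hm : 2 ≤ m) {R : Finset (Fin m)} (h1 : rimClass R 1 = 0)
    (h0 : rimClass R 0 ≠ 0) : R = ∅ := by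
  obtain ⟨i, hi⟩ := Finset.card_pos.mp (Nat.pos_of_ne_zero h0)
  rw [Finset.mem_filter] at hi
  have hstep : ∀ j, j ∉ R ∧ rimDegree R j = 0 → j + 1 ∉ R ∧ rimDegree R (j + 1) = 0 := by
    rintro j ⟨hj, hd⟩
    have hj1 : j + 1 ∉ R := by
      intro h
      simp [rimDegree, h] at hd
    refine ⟨hj1, ?_⟩
    rw [rimClass, Finset.card_eq_zero, Finset.filter_eq_empty_iff] at h1
    have hne : rimDegree R (j + 1) ≠ 1 := fun h => h1 (Finset.mem_univ (j + 1)) ⟨hj1, h⟩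
    simp only [rimDegree, add_sub_cancel_right, hj, if_false] at hne ⊢
    split_ifs at hne ⊢ <;> simp_all
  have hall : ∀ a : ℕ, ∀ j, (j - i).val = a → j ∉ R ∧ rimDegree R j = 0 := by
    intro a
    induction a with
    | zero =>
      intro j hj
      rw [Fin.val_eq_zero_iff, sub_eq_zero] at hj
      exact hj ▸ hi.2
    | succ a ih =>
      intro j hj
      have hprev : (j - 1 - i).val = a := by
        rw [sub_right_comm, Fin.val_sub_one_cyclic hm, hj]
        simp
      have := hstep _ (ih _ hprev)
      rwa [sub_add_cancel] at this
  exact Finset.eq_empty_of_forall_notMem fun j => (hall _ j rfl).1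

/-- The possible sizes of a `k`-MARS of the wheel, for odd `k`. -/
theorem isMARS_wheel_card {k : ℕ} (hm : 3 ≤ m) (hk : 3 < k) (hkm : k < m) (hko : k % 2 = 1)
    {S : Finset (Option (Fin m))} (hS : IsMARS (wheel m) S k) :
    (2 * k ≤ m ∧ #S = m - k + 1) ∨
      (5 * k + 3 ≤ 2 * m ∧ min ((m - k) / 3 + (m - k) % 3 + 1) ((3 * k + 3) / 2) ≤ #S) := by
  have hnone := none_mem_of_isMARS (by omega) hk hS
  obtain ⟨R, rfl⟩ : ∃ R, S = insertNone R := by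
    refine ⟨eraseNone S, ?_⟩
    rw [Finset.insertNone_eraseNone, Finset.insert_eq_self.mpr hnone]
  obtain ⟨hle, j, hj, hjk⟩ := (isMARS_insertNone_iff hm R (by omega)).mp hS
  have h0 := hle 0 (by omega)
  have h1 := hle 1 (by omega)
  have h2 := hle 2 (by omega)
  have hcard := rimClass_add_card R
  have hdouble := rimClass_one_add_two_mul R
  have hcons := card_eq_add_card_consecutive R
  have hempty : rimClass R 1 = 0 → rimClass R 0 ≠ 0 → #R = 0 := by
    intro h h'
    rw [eq_empty_of_rimClass_one_eq_zero (by omega) h h', Finset.card_empty]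
  rw [Finset.card_insertNone]
  by_cases hz : rimClass R 1 = 0
  · left
    by_cases hz' : rimClass R 0 = 0
    · interval_cases j <;> omega
    · have := hempty hz hz'
      interval_cases j <;> omega
  · right
    interval_cases j
    · rcases h2 with h2 | h2 <;> omega
    · omega
    · omega

/-- All complementary runs have length one. -/
theorem exists_isMARS_of_two_mul_le {k : ℕ} (hk : 2 ≤ k) (hm : 2 * k ≤ m) :
    ∃ S : Finset (Option (Fin m)), IsMARS (wheel m) S k ∧ #S = m - k + 1 := by
  let R : Finset (Fin m) := {i | 2 * k ≤ i.val ∨ i.val % 2 = 0}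
  have hmem : ∀ i, i ∈ R ↔ 2 * k ≤ i.val ∨ i.val % 2 = 0 := fun i => by simp [R]
  have hdeg : ∀ j < 2, rimClass R j = 0 := by
    intro j hj
    rw [rimClass, Finset.card_eq_zero, Finset.filter_eq_empty_iff]
    rintro i - ⟨hi, hd⟩
    have hlt := i.isLt
    rw [rimDegree] at hd
    simp only [hmem, Fin.val_add_one_cyclic (show 2 ≤ m by omega),
      Fin.val_sub_one_cyclic (show 2 ≤ m by omega)] at hi hd
    split_ifs at hd <;> omega
  have hF : #{i : Fin m | i ∈ R ∧ i + 1 ∈ R} = m - 2 * k := by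
    rw [← card_filter_val_Ico (m := m) le_rfl]
    congr 1
    ext i
    have hlt := i.isLt
    simp only [Finset.mem_filter, Finset.mem_univ, true_and, hmem,
      Fin.val_add_one_cyclic (show 2 ≤ m by omega)]
    split_ifs <;> omega
  have h0 := hdeg 0 (by omega)
  have h1 := hdeg 1 (by omega)
  have hcard := rimClass_add_card R
  have hdouble := rimClass_one_add_two_mul R
  have hcons := card_eq_add_card_consecutive R
  refine ⟨insertNone R, (isMARS_insertNone_iff (by omega) R (by omega)).mpr
    ⟨fun j hj => ?_, 2, by omega, by omega⟩, by rw [Finset.card_insertNone]; omega⟩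
  interval_cases j <;> omega

/-- No complementary run has length one. -/
theorem exists_isMARS_of_eq_add {k q t : ℕ} (hk : 2 ≤ k) (hq : k + 1 ≤ 2 * q)
    (hm : m = 3 * q + k + t) :
    ∃ S : Finset (Option (Fin m)), IsMARS (wheel m) S k ∧ #S = q + t + 1 := by
  let R : Finset (Fin m) := {i | (i.val < 3 * q ∧ i.val % 3 = 0) ∨ 3 * q + k ≤ i.val}
  have hmem : ∀ i, i ∈ R ↔ (i.val < 3 * q ∧ i.val % 3 = 0) ∨ 3 * q + k ≤ i.val :=
    fun i => by simp [R]
  have h2 : rimClass R 2 = 0 := by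
    rw [rimClass, Finset.card_eq_zero, Finset.filter_eq_empty_iff]
    rintro i - ⟨hi, hd⟩
    have hlt := i.isLt
    rw [rimDegree] at hd
    simp only [hmem, Fin.val_add_one_cyclic (show 2 ≤ m by omega),
      Fin.val_sub_one_cyclic (show 2 ≤ m by omega)] at hi hd
    split_ifs at hd <;> omega
  have h0 : rimClass R 0 = k := by
    have : (3 * q + k - 1) - (3 * q - 1) = k := by omega
    refine Eq.trans (congrArg Finset.card ?_)
      ((card_filter_val_Ico (m := m) (show 3 * q + k - 1 ≤ m by omega)).trans this)
    ext i
    have hlt := i.isLt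
    simp only [Finset.mem_filter, Finset.mem_univ, true_and, rimDegree_eq_zero_iff, hmem,
      Fin.val_add_one_cyclic (show 2 ≤ m by omega), Fin.val_sub_one_cyclic (show 2 ≤ m by omega)]
    split_ifs <;> omega
  have hF : #{i : Fin m | i ∈ R ∧ i + 1 ∈ R} = t := by
    have : m - (3 * q + k) = t := by omega
    refine Eq.trans (congrArg Finset.card ?_) ((card_filter_val_Ico (m := m) le_rfl).trans this)
    ext i
    have hlt := i.isLt
    simp only [Finset.mem_filter, Finset.mem_univ, true_and, hmem,
      Fin.val_add_one_cyclic (show 2 ≤ m by omega)]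
    split_ifs <;> omega
  have hcard := rimClass_add_card R
  have hdouble := rimClass_one_add_two_mul R
  have hcons := card_eq_add_card_consecutive R
  refine ⟨insertNone R, (isMARS_insertNone_iff (by omega) R (by omega)).mpr
    ⟨fun j hj => ?_, 0, by omega, by omega⟩, by rw [Finset.card_insertNone]; omega⟩
  interval_cases j <;> omega

/-- There are `k` complementary runs of length one and `h` longer ones. -/
theorem exists_isMARS_of_le {k h : ℕ} (hk : 2 ≤ k) (hh : k ≤ 2 * h)
    (hm : 3 * k + 3 * h ≤ m) :
    ∃ S : Finset (Option (Fin m)), IsMARS (wheel m) S k ∧ #S = k + h + 1 := by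
  let R : Finset (Fin m) :=
    {i | (i.val < 2 * k ∧ i.val % 2 = 0) ∨
      (2 * k ≤ i.val ∧ i.val < 2 * k + 3 * h ∧ (i.val + k) % 3 = 0)}
  have hmem : ∀ i, i ∈ R ↔ (i.val < 2 * k ∧ i.val % 2 = 0) ∨
      (2 * k ≤ i.val ∧ i.val < 2 * k + 3 * h ∧ (i.val + k) % 3 = 0) := fun i => by simp [R]
  have h2 : rimClass R 2 = k := by
    refine Eq.trans (congrArg Finset.card ?_)
      (card_filter_val_odd (m := m) (show 2 * k ≤ m by omega))
    ext i
    have hlt := i.isLt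
    simp only [Finset.mem_filter, Finset.mem_univ, true_and, rimDegree_eq_two_iff, hmem,
      Fin.val_add_one_cyclic (show 2 ≤ m by omega), Fin.val_sub_one_cyclic (show 2 ≤ m by omega)]
    split_ifs <;> omega
  have h0 : rimClass R 0 = m - 2 * k - 3 * h := by
    have : (m - 1) - (2 * k + 3 * h - 1) = m - 2 * k - 3 * h := by omega
    rw [← this, ← card_filter_val_Ico (m := m) (show m - 1 ≤ m by omega), rimClass]
    congr 1
    ext i
    have hlt := i.isLt
    simp only [Finset.mem_filter, Finset.mem_univ, true_and, rimDegree_eq_zero_iff, hmem,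
      Fin.val_add_one_cyclic (show 2 ≤ m by omega), Fin.val_sub_one_cyclic (show 2 ≤ m by omega)]
    split_ifs <;> omega
  have hF : #{i : Fin m | i ∈ R ∧ i + 1 ∈ R} = 0 := by
    rw [Finset.card_eq_zero, Finset.filter_eq_empty_iff]
    rintro i - hi
    have hlt := i.isLt
    simp only [hmem, Fin.val_add_one_cyclic (show 2 ≤ m by omega)] at hi
    split_ifs at hi <;> omega
  have hcard := rimClass_add_card R
  have hdouble := rimClass_one_add_two_mul R
  have hcons := card_eq_add_card_consecutive R
  refine ⟨insertNone R, (isMARS_insertNone_iff (by omega) R (by omega)).mpr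
    ⟨fun j hj => ?_, 2, by omega, by omega⟩, by rw [Finset.card_insertNone]; omega⟩
  interval_cases j <;> omega

end Wheel

/-- for the wheel `W_{1,n-1}` on `n ≥ 7` vertices and odd `k` with
`5 ≤ k < n - 1`, writing `t` for the remainder of `n - 1 - k` upon division by `3`:
(a) if `2n ≥ 5k + 5` then `msad_k(W_{1,n-1}) = min (⌊(n-1-k)/3⌋ + t + 1) ((3k+3)/2)`;
(b) if `2k < n` and `2n < 5k + 5` then `msad_k(W_{1,n-1}) = n - k`;
(c) if `n ≤ 2k` then `W_{1,n-1}` has no `k`-multiset antiresolving set. -/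
theorem stmt17 (n k : ℕ) (hn : 7 ≤ n) (hk5 : 5 ≤ k) (hkn : k < n - 1) (hko : k % 2 = 1)
    (t : ℕ) (ht : t = (n - 1 - k) % 3) :
    (5 * k + 5 ≤ 2 * n →
      MsadEq (wheel (n - 1)) k (min ((n - 1 - k) / 3 + t + 1) ((3 * k + 3) / 2))) ∧
    (2 * k < n → 2 * n < 5 * k + 5 → MsadEq (wheel (n - 1)) k (n - k)) ∧
    (n ≤ 2 * k →
      ∀ S : Finset (Option (Fin (n - 1))), ¬ IsMARS (wheel (n - 1)) S k) := by
  have : NeZero (n - 1) := ⟨by omega⟩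
  have hsize := fun S => isMARS_wheel_card (m := n - 1) (S := S) (by omega) (by omega) hkn hko
  refine ⟨fun h => ⟨?_, fun S hS => ?_⟩, fun h h' => ⟨?_, fun S hS => ?_⟩, fun h S hS => ?_⟩
  · by_cases hmin : (n - 1 - k) / 3 + t + 1 ≤ (3 * k + 3) / 2
    · rw [min_eq_left hmin]
      exact exists_isMARS_of_eq_add (by omega) (by omega) (by omega)
    · rw [min_eq_right (by omega), show (3 * k + 3) / 2 = k + (k + 1) / 2 + 1 by omega]
      exact exists_isMARS_of_le (by omega) (by omega) (by omega)
  · rcases hsize S hS with h | h <;> omega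
  · rw [show n - k = n - 1 - k + 1 by omega]
    exact exists_isMARS_of_two_mul_le (by omega) (by omega)
  · rcases hsize S hS with h | h <;> omega
  · rcases hsize S hS with h | h <;> omega
end
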